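/- arXiv:1411.3575 — 2 statements merged into one kernel-verified Lean document; each statement's English description precedes it below -/
import Mathlib

section
/- Suppose Φ : [0,∞) → ℝ is convex and admits the representation Φ(u) = βu² − ∫_{(0,1)} λu/(λu + 1 − λ) Υ(dλ) + au + b for all u ≥ 0, where β ≥ 0, a, b ∈ ℝ, Υ is a finite positive Borel measure on (0,1), and β > 0 or Υ((0,1)) > 0. Let K be a channel between nonempty finite alphabets X and Y with |X| ≥ 2 such that for every y ∈ Y there exists x with K(y|x) > 0. Then η_Φ(K) = S²(K), where S²(K) = sup over strictly positive distributions μ on X of S(μ,K)². -/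
open Finset

noncomputable section

namespace SDPI

variable {X Y : Type} [Fintype X] [Fintype Y]

def IsDist (μ : X → ℝ) : Prop := (∀ x, 0 ≤ μ x) ∧ ∑ x, μ x = 1

def IsPosDist (μ : X → ℝ) : Prop := (∀ x, 0 < μ x) ∧ ∑ x, μ x = 1

def IsChannel (K : X → Y → ℝ) : Prop :=
  (∀ x y, 0 ≤ K x y) ∧ ∀ x, ∑ y, K x y = 1

def push (μ : X → ℝ) (K : X → Y → ℝ) : Y → ℝ := fun y => ∑ x, μ x * K x y

def fDiv (Φ : ℝ → ℝ) (ν μ : X → ℝ) : ℝ := (∑ x, μ x * Φ (ν x / μ x)) - Φ 1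

def eta (Φ : ℝ → ℝ) (μ : X → ℝ) (K : X → Y → ℝ) : ℝ :=
  sSup { r | ∃ ν : X → ℝ, IsDist ν ∧ ν ≠ μ ∧
    r = fDiv Φ (push ν K) (push μ K) / fDiv Φ ν μ }

def etaSup (Φ : ℝ → ℝ) (K : X → Y → ℝ) : ℝ :=
  sSup { r | ∃ μ : X → ℝ, IsPosDist μ ∧ r = eta Φ μ K }

def maxCorr (μ : X → ℝ) (K : X → Y → ℝ) : ℝ :=
  sSup { r | ∃ (f : X → ℝ) (g : Y → ℝ),
    (∑ x, μ x * f x) = 0 ∧ (∑ y, push μ K y * g y) = 0 ∧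
    (∑ x, μ x * (f x) ^ 2) = 1 ∧ (∑ y, push μ K y * (g y) ^ 2) = 1 ∧
    r = ∑ x, ∑ y, μ x * K x y * (f x * g y) }

def adjoint (μ : X → ℝ) (K : X → Y → ℝ) : Y → X → ℝ :=
  fun y x => K x y * μ x / push μ K y

def Ent (Φ : ℝ → ℝ) (μ : X → ℝ) (f : X → ℝ) : ℝ :=
  (∑ x, μ x * Φ (f x)) - Φ (∑ x, μ x * f x)

def Var (μ : X → ℝ) (f : X → ℝ) : ℝ :=
  ∑ x, μ x * (f x - ∑ x', μ x' * f x') ^ 2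

def condExp (μ : X → ℝ) (K : X → Y → ℝ) (f : X → ℝ) : Y → ℝ :=
  fun y => (∑ x, μ x * K x y * f x) / push μ K y

def calE (μ : X → ℝ) (K : X → Y → ℝ) (f g : X → ℝ) : ℝ :=
  ∑ x, ∑ y, μ x * K x y *
    ((f x - condExp μ K f y) * (g x - condExp μ K g y))

def dirichlet (μ : X → ℝ) (M : X → X → ℝ) (f g : X → ℝ) : ℝ :=
  (1 / 2) * ∑ x, ∑ x', μ x * M x x' * ((f x - f x') * (g x - g x'))

def Homogeneous (Φ : ℝ → ℝ) : Prop :=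
  ∃ κ : ℝ → ℝ, (∀ c : ℝ, 0 < c → 0 < κ c) ∧
    ∀ (c : ℝ), 0 < c → ∀ (Z : Type) [Fintype Z], ∀ (μ : Z → ℝ),
      IsDist μ → ∀ f : Z → ℝ, (∀ z, 0 ≤ f z) →
        Ent Φ μ (fun z => c * f z) = κ c * Ent Φ μ f

def Subadditive (Φ : ℝ → ℝ) : Prop :=
  ∀ (n : ℕ) (Z : Fin n → Type) [∀ i, Fintype (Z i)],
    ∀ (μ : ∀ i, Z i → ℝ), (∀ i, IsDist (μ i)) →
    ∀ f : (∀ i, Z i) → ℝ, (∀ z, 0 ≤ f z) →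
      Ent Φ (fun z : ∀ i, Z i => ∏ i, μ i (z i)) f ≤
        ∑ i : Fin n,
          ((∑ z : ∀ j, Z j, (∏ j, μ j (z j)) * Φ (f z)) -
            ∑ z : ∀ j, Z j, (∏ j, μ j (z j)) *
              Φ (∑ w : Z i, μ i w * f (Function.update z i w)))


/-- The weighted quadratic form `∑ d² / m`, i.e. the `χ²`-type energy of `d` relative to `m`. -/
def chiSq {Z : Type} [Fintype Z] (m d : Z → ℝ) : ℝ := ∑ z, d z ^ 2 / m z

section Basic

variable {X Y Z : Type} [Fintype X] [Fintype Y] [Fintype Z]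

lemma chiSq_nonneg {m : Z → ℝ} (hm : ∀ z, 0 < m z) (d : Z → ℝ) : 0 ≤ chiSq m d :=
  sum_nonneg fun z _ => div_nonneg (sq_nonneg _) (hm z).le

lemma chiSq_smul (m d : Z → ℝ) (t : ℝ) : chiSq m (fun z => t * d z) = t ^ 2 * chiSq m d := by
  unfold chiSq
  rw [mul_sum]
  exact sum_congr rfl fun z _ => by ring

lemma sum_push {K : X → Y → ℝ} (hK : IsChannel K) (d : X → ℝ) :
    ∑ y, push d K y = ∑ x, d x := by
  unfold push
  rw [sum_comm]
  exact sum_congr rfl fun x _ => by rw [← mul_sum, hK.2 x, mul_one]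

lemma push_sub {W : Type} (ν μ : X → ℝ) (K : X → W → ℝ) (y : W) :
    push (fun x => ν x - μ x) K y = push ν K y - push μ K y := by
  simp only [push, sub_mul, sum_sub_distrib]

lemma push_smul {W : Type} (d : X → ℝ) (t : ℝ) (K : X → W → ℝ) (y : W) :
    push (fun x => t * d x) K y = t * push d K y := by
  simp only [push, mul_sum, mul_assoc]

lemma push_convexComb {W : Type} (ν μ : X → ℝ) (s t : ℝ) (K : X → W → ℝ) (y : W) :
    push (fun x => s * ν x + t * μ x) K y = s * push ν K y + t * push μ K y := by
  simp only [push, mul_sum, add_mul, sum_add_distrib, mul_assoc]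

lemma IsDist.push {K : X → Y → ℝ} (hK : IsChannel K) {ν : X → ℝ} (h : IsDist ν) :
    IsDist (push ν K) :=
  ⟨fun y => sum_nonneg fun x _ => mul_nonneg (h.1 x) (hK.1 x y), by rw [sum_push hK, h.2]⟩

lemma IsPosDist.push {K : X → Y → ℝ} (hK : IsChannel K) (hKpos : ∀ y : Y, ∃ x : X, 0 < K x y)
    {μ : X → ℝ} (h : IsPosDist μ) : IsPosDist (push μ K) := by
  refine ⟨fun y => ?_, by rw [sum_push hK, h.2]⟩
  obtain ⟨x, hx⟩ := hKpos y
  exact sum_pos' (fun x _ => mul_nonneg (h.1 x).le (hK.1 x y))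
    ⟨x, mem_univ x, mul_pos (h.1 x) hx⟩

lemma abs_push_sub_le {K : X → Y → ℝ} (hK : IsChannel K) {ν μ : X → ℝ} {δ : ℝ}
    (h : ∀ x, |ν x - μ x| ≤ δ * μ x) (y : Y) :
    |push ν K y - push μ K y| ≤ δ * push μ K y := by
  rw [← push_sub]
  unfold push
  rw [mul_sum]
  refine (abs_sum_le_sum_abs _ _).trans (sum_le_sum fun x _ => ?_)
  rw [abs_mul, abs_of_nonneg (hK.1 x y), ← mul_assoc]
  exact mul_le_mul_of_nonneg_right (h x) (hK.1 x y)

lemma corr_eq_sum_push (μ : X → ℝ) (K : X → Y → ℝ) (f : X → ℝ) (g : Y → ℝ) :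
    ∑ x, ∑ y, μ x * K x y * (f x * g y) = ∑ y, push (fun x => μ x * f x) K y * g y := by
  unfold push
  rw [sum_comm]
  refine sum_congr rfl fun y _ => ?_
  rw [sum_mul]
  exact sum_congr rfl fun x _ => by ring

end Basic

section MaxCorr

variable {X Y : Type} [Fintype X] [Fintype Y]

lemma corr_le_one {μ : X → ℝ} (hμ : IsPosDist μ) {K : X → Y → ℝ} (hK : IsChannel K)
    {f : X → ℝ} {g : Y → ℝ} (hf : ∑ x, μ x * f x ^ 2 = 1) (hg : ∑ y, push μ K y * g y ^ 2 = 1) :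
    ∑ x, ∑ y, μ x * K x y * (f x * g y) ≤ 1 := by
  have h1 : ∑ x, ∑ y, μ x * K x y * f x ^ 2 = 1 := by
    rw [← hf]
    refine sum_congr rfl fun x _ => ?_
    rw [← sum_mul, ← mul_sum, hK.2 x, mul_one]
  have h2 : ∑ x, ∑ y, μ x * K x y * g y ^ 2 = 1 := by
    rw [← hg, sum_comm]
    exact sum_congr rfl fun y _ => by rw [← sum_mul]; rfl
  have h3 : ∑ x, ∑ y, μ x * K x y * (f x * g y)
      ≤ ∑ x, ∑ y, (μ x * K x y * f x ^ 2 / 2 + μ x * K x y * g y ^ 2 / 2) := by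
    refine sum_le_sum fun x _ => sum_le_sum fun y _ => ?_
    have := mul_nonneg (mul_nonneg (hμ.1 x).le (hK.1 x y)) (sq_nonneg (f x - g y))
    nlinarith
  simp only [sum_add_distrib, ← sum_div, h1, h2] at h3
  linarith

lemma bddAbove_corr {μ : X → ℝ} (hμ : IsPosDist μ) {K : X → Y → ℝ} (hK : IsChannel K) :
    BddAbove { r | ∃ (f : X → ℝ) (g : Y → ℝ),
      (∑ x, μ x * f x) = 0 ∧ (∑ y, push μ K y * g y) = 0 ∧
      (∑ x, μ x * (f x) ^ 2) = 1 ∧ (∑ y, push μ K y * (g y) ^ 2) = 1 ∧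
      r = ∑ x, ∑ y, μ x * K x y * (f x * g y) } := by
  refine ⟨1, ?_⟩
  rintro r ⟨f, g, -, -, hf, hg, rfl⟩
  exact corr_le_one hμ hK hf hg

lemma maxCorr_nonneg {μ : X → ℝ} (hμ : IsPosDist μ) {K : X → Y → ℝ} (hK : IsChannel K) :
    0 ≤ maxCorr μ K := by
  unfold maxCorr
  by_contra! hneg
  obtain ⟨r, f, g, hf0, hg0, hf, hg, hr⟩ : Set.Nonempty { r | ∃ (f : X → ℝ) (g : Y → ℝ),
      (∑ x, μ x * f x) = 0 ∧ (∑ y, push μ K y * g y) = 0 ∧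
      (∑ x, μ x * (f x) ^ 2) = 1 ∧ (∑ y, push μ K y * (g y) ^ 2) = 1 ∧
      r = ∑ x, ∑ y, μ x * K x y * (f x * g y) } := by
    by_contra! hemp
    rw [hemp, Real.sSup_empty] at hneg
    exact lt_irrefl _ hneg
  have h1 := le_csSup (bddAbove_corr hμ hK) ⟨f, g, hf0, hg0, hf, hg, hr⟩
  have h2 := le_csSup (bddAbove_corr hμ hK) (a := -r)
    ⟨f, fun y => - g y, hf0, by simp [hg0], hf, by simp [hg], by simp [hr]⟩
  linarith

lemma maxCorr_sq_le_one {μ : X → ℝ} (hμ : IsPosDist μ) {K : X → Y → ℝ} (hK : IsChannel K) :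
    maxCorr μ K ^ 2 ≤ 1 := by
  refine pow_le_one₀ (maxCorr_nonneg hμ hK) (Real.sSup_le ?_ zero_le_one)
  rintro r ⟨f, g, -, -, hf, hg, rfl⟩
  exact corr_le_one hμ hK hf hg

lemma bddAbove_maxCorr_sq {K : X → Y → ℝ} (hK : IsChannel K) :
    BddAbove { r | ∃ μ : X → ℝ, IsPosDist μ ∧ r = (maxCorr μ K) ^ 2 } := by
  refine ⟨1, ?_⟩
  rintro r ⟨μ, hμ, rfl⟩
  exact maxCorr_sq_le_one hμ hK

/-- `χ²`-contraction with the squared maximal correlation as constant. -/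
lemma chiSq_push_le {K : X → Y → ℝ} (hK : IsChannel K) (hKpos : ∀ y : Y, ∃ x : X, 0 < K x y)
    {m : X → ℝ} (hm : IsPosDist m) {d : X → ℝ} (hd : ∑ x, d x = 0) :
    chiSq (push m K) (push d K) ≤ maxCorr m K ^ 2 * chiSq m d := by
  have hmK := hm.push hK hKpos
  have hmne : ∀ x, m x ≠ 0 := fun x => (hm.1 x).ne'
  have hmKne : ∀ y, push m K y ≠ 0 := fun y => (hmK.1 y).ne'
  rcases (chiSq_nonneg hmK.1 (push d K)).eq_or_lt with h0 | hQK
  · rw [← h0]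
    exact mul_nonneg (sq_nonneg _) (chiSq_nonneg hm.1 d)
  have hQ : 0 < chiSq m d := by
    refine (chiSq_nonneg hm.1 d).lt_of_ne fun h => hQK.ne' ?_
    have hz : ∀ x, d x = 0 := by
      intro x
      have := (sum_eq_zero_iff_of_nonneg
        (fun z _ => div_nonneg (sq_nonneg (d z)) (hm.1 z).le)).1 h.symm x (mem_univ x)
      simpa [hmne x] using this
    simp [chiSq, push, hz]
  set Q := chiSq m d
  set R := chiSq (push m K) (push d K)
  have hsQ := Real.sqrt_pos.2 hQ
  have hsR := Real.sqrt_pos.2 hQK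
  have hsQ2 := Real.sq_sqrt hQ.le
  have hsR2 := Real.sq_sqrt hQK.le
  have hpush : push (fun x => m x * (d x / m x / √Q)) K = fun y => push d K y / √Q := by
    funext y
    unfold push
    rw [sum_div]
    exact sum_congr rfl fun x _ => by field_simp [hmne x]
  have hmem : √R / √Q ≤ maxCorr m K := by
    refine le_csSup (bddAbove_corr hm hK)
      ⟨fun x => d x / m x / √Q, fun y => push d K y / push m K y / √R, ?_, ?_, ?_, ?_, ?_⟩
    · have : ∀ x, m x * (d x / m x / √Q) = d x / √Q := fun x => by field_simp [hmne x]
      simp only [this, ← sum_div, hd, zero_div]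
    · have : ∀ y, push m K y * (push d K y / push m K y / √R) = push d K y / √R :=
        fun y => by field_simp [hmKne y]
      simp only [this, ← sum_div, sum_push hK, hd, zero_div]
    · have : ∀ x, m x * (d x / m x / √Q) ^ 2 = (d x ^ 2 / m x) / Q := fun x => by
        rw [div_pow, hsQ2]; field_simp [hmne x]
      simp only [this, ← sum_div]
      exact div_self hQ.ne'
    · have : ∀ y, push m K y * (push d K y / push m K y / √R) ^ 2
          = (push d K y ^ 2 / push m K y) / R := fun y => by
        rw [div_pow, hsR2]; field_simp [hmKne y]
      simp only [this, ← sum_div]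
      exact div_self hQK.ne'
    · rw [corr_eq_sum_push, hpush]
      have : ∀ y, push d K y / √Q * (push d K y / push m K y / √R)
          = (push d K y ^ 2 / push m K y) / (√Q * √R) := fun y => by field_simp [hmKne y]
      simp only [this, ← sum_div]
      change _ = R / _
      rw [div_eq_div_iff hsQ.ne' (mul_pos hsQ hsR).ne']
      nlinarith
  have h2 : (√R / √Q) ^ 2 ≤ maxCorr m K ^ 2 := pow_le_pow_left₀ (by positivity) hmem 2
  rwa [div_pow, hsQ2, hsR2, div_le_iff₀ hQ] at h2

lemma sq_corr_le_chiSq_push {μ : X → ℝ} {K : X → Y → ℝ} (hμK : ∀ y, 0 < push μ K y)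
    (f : X → ℝ) {g : Y → ℝ} (hg : ∑ y, push μ K y * g y ^ 2 = 1) :
    (∑ x, ∑ y, μ x * K x y * (f x * g y)) ^ 2
      ≤ chiSq (push μ K) (push (fun x => μ x * f x) K) := by
  rw [corr_eq_sum_push]
  have := sum_sq_le_sum_mul_sum_of_sq_le_mul univ
    (r := fun y => push (fun x => μ x * f x) K y * g y)
    (f := fun y => push (fun x => μ x * f x) K y ^ 2 / push μ K y)
    (g := fun y => push μ K y * g y ^ 2)
    (fun y _ => div_nonneg (sq_nonneg _) (hμK y).le)
    (fun y _ => mul_nonneg (hμK y).le (sq_nonneg _))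
    (fun y _ => le_of_eq (by have := (hμK y).ne'; field_simp))
  rwa [hg, mul_one] at this

end MaxCorr

section Representation

open MeasureTheory

variable {Z : Type} [Fintype Z] {Υ : Measure ℝ} [IsFiniteMeasure Υ]

lemma integrableOn_of_bounded {h : ℝ → ℝ} (hm : Measurable h) (C : ℝ)
    (hb : ∀ l ∈ Set.Ioo (0 : ℝ) 1, |h l| ≤ C) : IntegrableOn h (Set.Ioo 0 1) Υ := by
  refine Integrable.of_bound hm.aestronglyMeasurable C ?_
  filter_upwards [ae_restrict_mem measurableSet_Ioo] with l hl using hb l hl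

lemma integrableOn_weight :
    IntegrableOn (fun l : ℝ => l ^ 2 * (1 - l)) (Set.Ioo 0 1) Υ := by
  refine integrableOn_of_bounded (by fun_prop) 1 fun l hl => ?_
  have h1 : 0 ≤ 1 - l := by linarith [hl.2]
  rw [abs_of_nonneg (mul_nonneg (sq_nonneg l) h1)]
  exact mul_le_one₀ (pow_le_one₀ hl.1.le hl.2.le) h1 (by linarith [hl.1])

lemma integrableOn_loewner {u : ℝ} (hu : 0 ≤ u) :
    IntegrableOn (fun l : ℝ => l * u / (l * u + 1 - l)) (Set.Ioo 0 1) Υ := by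
  refine integrableOn_of_bounded (by fun_prop) 1 fun l hl => ?_
  have h1 : 0 ≤ l * u := mul_nonneg hl.1.le hu
  have h2 : 0 < l * u + 1 - l := by linarith [hl.2]
  rw [abs_of_nonneg (div_nonneg h1 h2.le), div_le_one h2]
  linarith [hl.2]

/-- For a Loewner kernel the divergence is a `χ²`-energy relative to the mixture of the two
distributions. -/
lemma sum_loewner {μ ν : Z → ℝ} (hμ : IsPosDist μ) (hν : IsDist ν) {l : ℝ}
    (hl : l ∈ Set.Ioo (0 : ℝ) 1) :
    l - ∑ z, μ z * (l * (ν z / μ z) / (l * (ν z / μ z) + 1 - l))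
      = l ^ 2 * (1 - l) * chiSq (fun z => l * ν z + (1 - l) * μ z) (fun z => ν z - μ z) := by
  have hterm : ∀ z, μ z * (l * (ν z / μ z) / (l * (ν z / μ z) + 1 - l))
      = l * (l * ν z + (1 - l) * μ z) + l * (1 - 2 * l) * (ν z - μ z)
        - l ^ 2 * (1 - l) * ((ν z - μ z) ^ 2 / (l * ν z + (1 - l) * μ z)) := by
    intro z
    have h1 := hμ.1 z
    have hm : 0 < l * ν z + (1 - l) * μ z :=
      add_pos_of_nonneg_of_pos (mul_nonneg hl.1.le (hν.1 z)) (mul_pos (by linarith [hl.2]) h1)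
    have h2 : l * (ν z / μ z) + 1 - l = (l * ν z + (1 - l) * μ z) / μ z := by field_simp; ring
    rw [h2]
    generalize hM : l * ν z + (1 - l) * μ z = M at hm
    field_simp
    rw [← hM]
    ring
  simp only [hterm, sum_sub_distrib, sum_add_distrib, ← mul_sum, hμ.2, hν.2]
  unfold chiSq
  ring

lemma IsPosDist.mixture {μ ν : Z → ℝ} (hμ : IsPosDist μ) (hν : IsDist ν) {l : ℝ}
    (hl : l ∈ Set.Ioo (0 : ℝ) 1) : IsPosDist (fun z => l * ν z + (1 - l) * μ z) := by
  refine ⟨fun z => add_pos_of_nonneg_of_pos (mul_nonneg hl.1.le (hν.1 z))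
    (mul_pos (by linarith [hl.2]) (hμ.1 z)), ?_⟩
  rw [sum_add_distrib, ← mul_sum, ← mul_sum, hμ.2, hν.2]
  ring

lemma integrableOn_chiSq_mixture {μ ν : Z → ℝ} (hμ : IsPosDist μ) (hν : IsDist ν) :
    IntegrableOn (fun l : ℝ => l ^ 2 * (1 - l) *
      chiSq (fun z => l * ν z + (1 - l) * μ z) (fun z => ν z - μ z)) (Set.Ioo 0 1) Υ := by
  have h : IntegrableOn (fun l : ℝ => l - ∑ z, μ z *
      (l * (ν z / μ z) / (l * (ν z / μ z) + 1 - l))) (Set.Ioo 0 1) Υ := by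
    refine Integrable.sub (integrableOn_of_bounded measurable_id 1 fun l hl => ?_) ?_
    · exact (abs_of_pos hl.1).trans_le hl.2.le
    · exact integrable_finsetSum _ fun z _ =>
        (integrableOn_loewner (div_nonneg (hν.1 z) (hμ.1 z).le)).const_mul _
  exact h.congr_fun (fun l hl => sum_loewner hμ hν hl) measurableSet_Ioo

lemma fDiv_eq {Φ : ℝ → ℝ} {β a b : ℝ}
    (hrep : ∀ u : ℝ, 0 ≤ u →
      Φ u = β * u ^ 2 - (∫ l in Set.Ioo (0:ℝ) 1, l * u / (l * u + 1 - l) ∂Υ) + a * u + b)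
    {μ ν : Z → ℝ} (hμ : IsPosDist μ) (hν : IsDist ν) :
    fDiv Φ ν μ = β * chiSq μ (fun z => ν z - μ z)
      + ∫ l in Set.Ioo (0:ℝ) 1, l ^ 2 * (1 - l) *
        chiSq (fun z => l * ν z + (1 - l) * μ z) (fun z => ν z - μ z) ∂Υ := by
  have hu : ∀ z, 0 ≤ ν z / μ z := fun z => div_nonneg (hν.1 z) (hμ.1 z).le
  have hint : IntegrableOn (fun l : ℝ => l) (Set.Ioo 0 1) Υ :=
    integrableOn_of_bounded measurable_id 1 fun l hl => by
      exact (abs_of_pos hl.1).trans_le hl.2.le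
  have hI : ∫ l in Set.Ioo (0:ℝ) 1, l ^ 2 * (1 - l) *
        chiSq (fun z => l * ν z + (1 - l) * μ z) (fun z => ν z - μ z) ∂Υ
      = (∫ l in Set.Ioo (0:ℝ) 1, l ∂Υ) - ∑ z, μ z *
        ∫ l in Set.Ioo (0:ℝ) 1, l * (ν z / μ z) / (l * (ν z / μ z) + 1 - l) ∂Υ := by
    rw [← setIntegral_congr_fun measurableSet_Ioo (fun l hl => sum_loewner hμ hν hl),
      integral_sub hint (integrable_finsetSum _ fun z _ =>
        (integrableOn_loewner (hu z)).const_mul _),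
      integral_finsetSum _ fun z _ => (integrableOn_loewner (hu z)).const_mul _]
    simp only [integral_const_mul]
  have hone : Φ 1 = β - (∫ l in Set.Ioo (0:ℝ) 1, l ∂Υ) + a + b := by
    rw [hrep 1 zero_le_one]
    simp
  have hterm : ∀ z, μ z * Φ (ν z / μ z) = β * ((ν z - μ z) ^ 2 / μ z) + β * (2 * ν z - μ z)
      - μ z * (∫ l in Set.Ioo (0:ℝ) 1, l * (ν z / μ z) / (l * (ν z / μ z) + 1 - l) ∂Υ)
      + a * ν z + b * μ z := by
    intro z
    rw [hrep _ (hu z)]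
    generalize (∫ l in Set.Ioo (0:ℝ) 1, l * (ν z / μ z) / (l * (ν z / μ z) + 1 - l) ∂Υ) = J
    have := (hμ.1 z).ne'
    field_simp
    ring
  rw [hI, fDiv, hone]
  simp only [hterm, sum_sub_distrib, sum_add_distrib, ← mul_sum, hμ.2, hν.2]
  unfold chiSq
  ring

lemma integral_weight_add_pos {β : ℝ} (hβ : 0 ≤ β)
    (hnontriv : 0 < β ∨ 0 < Υ (Set.Ioo (0:ℝ) 1)) :
    0 < β + ∫ l in Set.Ioo (0:ℝ) 1, l ^ 2 * (1 - l) ∂Υ := by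
  have hpos : ∀ l ∈ Set.Ioo (0:ℝ) 1, 0 < l ^ 2 * (1 - l) := fun l hl =>
    mul_pos (pow_pos hl.1 2) (by linarith [hl.2])
  rcases hnontriv with h | h
  · exact add_pos_of_pos_of_nonneg h
      (setIntegral_nonneg measurableSet_Ioo fun l hl => (hpos l hl).le)
  · refine add_pos_of_nonneg_of_pos hβ ?_
    rw [setIntegral_pos_iff_support_of_nonneg_ae]
    · refine h.trans_le (measure_mono fun l hl => ⟨(hpos l hl).ne', hl⟩)
    · filter_upwards [ae_restrict_mem measurableSet_Ioo] with l hl using (hpos l hl).le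
    · exact integrableOn_weight

lemma chiSq_le_of_le {m m' : Z → ℝ} (hm' : ∀ z, 0 < m' z) {c : ℝ} (hc : 0 < c)
    (h : ∀ z, c * m' z ≤ m z) (d : Z → ℝ) : chiSq m d ≤ c⁻¹ * chiSq m' d := by
  unfold chiSq
  rw [mul_sum]
  refine sum_le_sum fun z _ => ?_
  rw [show c⁻¹ * (d z ^ 2 / m' z) = d z ^ 2 / (c * m' z) by
    have := (hm' z).ne'; field_simp]
  exact div_le_div_of_nonneg_left (sq_nonneg _) (mul_pos hc (hm' z)) (h z)

lemma fDiv_le_of_abs_sub_le {Φ : ℝ → ℝ} {β a b : ℝ} (hβ : 0 ≤ β)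
    (hrep : ∀ u : ℝ, 0 ≤ u →
      Φ u = β * u ^ 2 - (∫ l in Set.Ioo (0:ℝ) 1, l * u / (l * u + 1 - l) ∂Υ) + a * u + b)
    {μ ν : Z → ℝ} (hμ : IsPosDist μ) (hν : IsDist ν) {δ : ℝ} (hδ0 : 0 ≤ δ) (hδ : δ < 1)
    (h : ∀ z, |ν z - μ z| ≤ δ * μ z) :
    fDiv Φ ν μ ≤ (1 - δ)⁻¹ * ((β + ∫ l in Set.Ioo (0:ℝ) 1, l ^ 2 * (1 - l) ∂Υ) *
      chiSq μ (fun z => ν z - μ z)) := by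
  rw [fDiv_eq hrep hμ hν]
  set d := fun z => ν z - μ z with hd
  have hQ := chiSq_nonneg hμ.1 d
  have hinv : 1 ≤ (1 - δ)⁻¹ := (one_le_inv₀ (by linarith)).2 (by linarith)
  have h1 : β * chiSq μ d ≤ (1 - δ)⁻¹ * (β * chiSq μ d) :=
    le_mul_of_one_le_left (mul_nonneg hβ hQ) hinv
  have h2 : ∫ l in Set.Ioo (0:ℝ) 1, l ^ 2 * (1 - l) *
        chiSq (fun z => l * ν z + (1 - l) * μ z) d ∂Υ
      ≤ ∫ l in Set.Ioo (0:ℝ) 1, l ^ 2 * (1 - l) * ((1 - δ)⁻¹ * chiSq μ d) ∂Υ := by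
    refine setIntegral_mono_on (integrableOn_chiSq_mixture hμ hν)
      (integrableOn_weight.mul_const _) measurableSet_Ioo fun l hl => ?_
    refine mul_le_mul_of_nonneg_left (chiSq_le_of_le hμ.1 (by linarith) (fun z => ?_) d)
      (mul_nonneg (sq_nonneg l) (by linarith [hl.2]))
    have h3 := neg_le_of_abs_le (h z)
    have h4 := mul_nonneg hδ0 (hμ.1 z).le
    nlinarith [hl.1, hl.2]
  rw [integral_mul_const] at h2
  linarith

lemma le_fDiv_of_abs_sub_le {Φ : ℝ → ℝ} {β a b : ℝ} (hβ : 0 ≤ β)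
    (hrep : ∀ u : ℝ, 0 ≤ u →
      Φ u = β * u ^ 2 - (∫ l in Set.Ioo (0:ℝ) 1, l * u / (l * u + 1 - l) ∂Υ) + a * u + b)
    {μ ν : Z → ℝ} (hμ : IsPosDist μ) (hν : IsDist ν) {δ : ℝ} (hδ0 : 0 ≤ δ)
    (h : ∀ z, |ν z - μ z| ≤ δ * μ z) :
    (1 + δ)⁻¹ * ((β + ∫ l in Set.Ioo (0:ℝ) 1, l ^ 2 * (1 - l) ∂Υ) *
      chiSq μ (fun z => ν z - μ z)) ≤ fDiv Φ ν μ := by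
  rw [fDiv_eq hrep hμ hν]
  set d := fun z => ν z - μ z with hd
  have hQ := chiSq_nonneg hμ.1 d
  have h1 : (1 + δ)⁻¹ * (β * chiSq μ d) ≤ β * chiSq μ d :=
    mul_le_of_le_one_left (mul_nonneg hβ hQ) (inv_le_one_of_one_le₀ (by linarith))
  have h2 : ∫ l in Set.Ioo (0:ℝ) 1, l ^ 2 * (1 - l) * ((1 + δ)⁻¹ * chiSq μ d) ∂Υ
      ≤ ∫ l in Set.Ioo (0:ℝ) 1, l ^ 2 * (1 - l) *
        chiSq (fun z => l * ν z + (1 - l) * μ z) d ∂Υ := by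
    refine setIntegral_mono_on (integrableOn_weight.mul_const _)
      (integrableOn_chiSq_mixture hμ hν) measurableSet_Ioo fun l hl => ?_
    refine mul_le_mul_of_nonneg_left ?_ (mul_nonneg (sq_nonneg l) (by linarith [hl.2]))
    rw [inv_mul_le_iff₀ (by linarith)]
    have h5 := chiSq_le_of_le (m := μ) (hμ.mixture hν hl).1 (c := (1 + δ)⁻¹) (by positivity)
      (fun z => ?_) d
    · rwa [inv_inv] at h5
    rw [inv_mul_le_iff₀ (by linarith)]
    have h3 := le_of_abs_le (h z)
    have h4 := mul_nonneg hδ0 (hμ.1 z).le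
    nlinarith [hl.1, hl.2]
  rw [integral_mul_const] at h2
  linarith

end Representation

section Eta

open MeasureTheory

variable {X Y : Type} [Fintype X] [Fintype Y] {Υ : Measure ℝ} [IsFiniteMeasure Υ]
  {Φ : ℝ → ℝ} {β a b : ℝ} {K : X → Y → ℝ}

lemma fDiv_nonneg {Z : Type} [Fintype Z] (hβ : 0 ≤ β)
    (hrep : ∀ u : ℝ, 0 ≤ u →
      Φ u = β * u ^ 2 - (∫ l in Set.Ioo (0:ℝ) 1, l * u / (l * u + 1 - l) ∂Υ) + a * u + b)
    {μ ν : Z → ℝ} (hμ : IsPosDist μ) (hν : IsDist ν) : 0 ≤ fDiv Φ ν μ := by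
  rw [fDiv_eq hrep hμ hν]
  refine add_nonneg (mul_nonneg hβ (chiSq_nonneg hμ.1 _))
    (setIntegral_nonneg measurableSet_Ioo fun l hl => ?_)
  exact mul_nonneg (mul_nonneg (sq_nonneg l) (by linarith [hl.2]))
    (chiSq_nonneg (hμ.mixture hν hl).1 _)

lemma fDiv_push_le (hβ : 0 ≤ β)
    (hrep : ∀ u : ℝ, 0 ≤ u →
      Φ u = β * u ^ 2 - (∫ l in Set.Ioo (0:ℝ) 1, l * u / (l * u + 1 - l) ∂Υ) + a * u + b)
    (hK : IsChannel K) (hKpos : ∀ y : Y, ∃ x : X, 0 < K x y)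
    {μ ν : X → ℝ} (hμ : IsPosDist μ) (hν : IsDist ν) {s : ℝ}
    (hs : ∀ m : X → ℝ, IsPosDist m → maxCorr m K ^ 2 ≤ s) :
    fDiv Φ (push ν K) (push μ K) ≤ s * fDiv Φ ν μ := by
  rw [fDiv_eq hrep hμ hν, fDiv_eq hrep (hμ.push hK hKpos) (hν.push hK), mul_add,
    ← integral_const_mul]
  have hd : ∑ x, (ν x - μ x) = 0 := by rw [sum_sub_distrib, hμ.2, hν.2, sub_self]
  have key : ∀ m : X → ℝ, IsPosDist m →
      chiSq (push m K) (fun y => push ν K y - push μ K y)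
        ≤ s * chiSq m (fun x => ν x - μ x) := by
    intro m hm
    have h := chiSq_push_le hK hKpos hm hd
    rw [show push (fun x => ν x - μ x) K = fun y => push ν K y - push μ K y from
      funext (push_sub ν μ K)] at h
    exact h.trans (mul_le_mul_of_nonneg_right (hs m hm) (chiSq_nonneg hm.1 _))
  refine add_le_add ?_ (setIntegral_mono_on
    (integrableOn_chiSq_mixture (hμ.push hK hKpos) (hν.push hK))
    ((integrableOn_chiSq_mixture hμ hν).const_mul s) measurableSet_Ioo fun l hl => ?_)
  · calc _ ≤ β * (s * chiSq μ (fun x => ν x - μ x)) :=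
          mul_le_mul_of_nonneg_left (key μ hμ) hβ
      _ = _ := by ring
  · have h := key _ (hμ.mixture hν hl)
    rw [show push (fun x => l * ν x + (1 - l) * μ x) K
      = fun y => l * push ν K y + (1 - l) * push μ K y from
      funext (push_convexComb ν μ l (1 - l) K)] at h
    calc _ ≤ l ^ 2 * (1 - l) * (s * chiSq (fun x => l * ν x + (1 - l) * μ x)
            (fun x => ν x - μ x)) :=
          mul_le_mul_of_nonneg_left h (mul_nonneg (sq_nonneg l) (by linarith [hl.2]))
      _ = _ := by ring

lemma fDiv_ratio_le (hβ : 0 ≤ β)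
    (hrep : ∀ u : ℝ, 0 ≤ u →
      Φ u = β * u ^ 2 - (∫ l in Set.Ioo (0:ℝ) 1, l * u / (l * u + 1 - l) ∂Υ) + a * u + b)
    (hK : IsChannel K) (hKpos : ∀ y : Y, ∃ x : X, 0 < K x y)
    {μ ν : X → ℝ} (hμ : IsPosDist μ) (hν : IsDist ν) {s : ℝ}
    (hs : ∀ m : X → ℝ, IsPosDist m → maxCorr m K ^ 2 ≤ s) :
    fDiv Φ (push ν K) (push μ K) / fDiv Φ ν μ ≤ s :=
  div_le_of_le_mul₀ (fDiv_nonneg hβ hrep hμ hν) ((sq_nonneg _).trans (hs μ hμ))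
    (fDiv_push_le hβ hrep hK hKpos hμ hν hs)

lemma eta_le (hβ : 0 ≤ β)
    (hrep : ∀ u : ℝ, 0 ≤ u →
      Φ u = β * u ^ 2 - (∫ l in Set.Ioo (0:ℝ) 1, l * u / (l * u + 1 - l) ∂Υ) + a * u + b)
    (hK : IsChannel K) (hKpos : ∀ y : Y, ∃ x : X, 0 < K x y)
    {μ : X → ℝ} (hμ : IsPosDist μ) {s : ℝ}
    (hs : ∀ m : X → ℝ, IsPosDist m → maxCorr m K ^ 2 ≤ s) : eta Φ μ K ≤ s := by
  refine Real.sSup_le ?_ ((sq_nonneg _).trans (hs μ hμ))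
  rintro r ⟨ν, hν, -, rfl⟩
  exact fDiv_ratio_le hβ hrep hK hKpos hμ hν hs

lemma fDiv_ratio_le_eta (hβ : 0 ≤ β)
    (hrep : ∀ u : ℝ, 0 ≤ u →
      Φ u = β * u ^ 2 - (∫ l in Set.Ioo (0:ℝ) 1, l * u / (l * u + 1 - l) ∂Υ) + a * u + b)
    (hK : IsChannel K) (hKpos : ∀ y : Y, ∃ x : X, 0 < K x y)
    {μ ν : X → ℝ} (hμ : IsPosDist μ) (hν : IsDist ν) (hne : ν ≠ μ) :
    fDiv Φ (push ν K) (push μ K) / fDiv Φ ν μ ≤ eta Φ μ K := by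
  refine le_csSup ⟨1, ?_⟩ ⟨ν, hν, hne, rfl⟩
  rintro r ⟨ν', hν', -, rfl⟩
  exact fDiv_ratio_le hβ hrep hK hKpos hμ hν' fun m hm => maxCorr_sq_le_one hm hK

lemma eta_nonneg (hβ : 0 ≤ β)
    (hrep : ∀ u : ℝ, 0 ≤ u →
      Φ u = β * u ^ 2 - (∫ l in Set.Ioo (0:ℝ) 1, l * u / (l * u + 1 - l) ∂Υ) + a * u + b)
    (hK : IsChannel K) (hKpos : ∀ y : Y, ∃ x : X, 0 < K x y)
    {μ : X → ℝ} (hμ : IsPosDist μ) : 0 ≤ eta Φ μ K := by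
  refine Real.sSup_nonneg ?_
  rintro r ⟨ν, hν, -, rfl⟩
  exact div_nonneg (fDiv_nonneg hβ hrep (hμ.push hK hKpos) (hν.push hK))
    (fDiv_nonneg hβ hrep hμ hν)

/-- Local perturbations `μ (1 + t f)` show that the SDPI constant dominates the `χ²`-contraction
of every normalized function, up to a factor tending to one. -/
lemma chiSq_push_le_eta_of_lt_one (hβ : 0 ≤ β)
    (hrep : ∀ u : ℝ, 0 ≤ u →
      Φ u = β * u ^ 2 - (∫ l in Set.Ioo (0:ℝ) 1, l * u / (l * u + 1 - l) ∂Υ) + a * u + b)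
    (hnontriv : 0 < β ∨ 0 < Υ (Set.Ioo (0:ℝ) 1))
    (hK : IsChannel K) (hKpos : ∀ y : Y, ∃ x : X, 0 < K x y)
    {μ : X → ℝ} (hμ : IsPosDist μ) {f : X → ℝ} (hf0 : ∑ x, μ x * f x = 0)
    (hf1 : ∑ x, μ x * f x ^ 2 = 1) {δ : ℝ} (hδ0 : 0 < δ) (hδ : δ < 1) :
    (1 - δ) * chiSq (push μ K) (push (fun x => μ x * f x) K) ≤ (1 + δ) * eta Φ μ K := by
  set d : X → ℝ := fun x => μ x * f x with hd
  have hQ1 : chiSq μ d = 1 := by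
    rw [← hf1]
    refine sum_congr rfl fun x _ => ?_
    have := (hμ.1 x).ne'
    simp only [hd]
    field_simp
  set C : ℝ := ∑ x, |f x| + 1 with hC
  have hCpos : 0 < C := add_pos_of_nonneg_of_pos (sum_nonneg fun x _ => abs_nonneg _) one_pos
  have hfC : ∀ x, |f x| ≤ C := fun x =>
    (single_le_sum (f := fun x => |f x|) (fun x _ => abs_nonneg _) (mem_univ x)).trans
      (by linarith)
  set t : ℝ := δ / C with ht
  have htpos : 0 < t := div_pos hδ0 hCpos
  set ν : X → ℝ := fun x => μ x + t * d x with hνdef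
  have hsub : (fun x => ν x - μ x) = fun x => t * d x := by
    funext x; simp [hνdef]
  have hsubK : (fun y => push ν K y - push μ K y) = fun y => t * push d K y := by
    funext y; rw [← push_sub, hsub, push_smul]
  have hclose : ∀ x, |ν x - μ x| ≤ δ * μ x := by
    intro x
    rw [show ν x - μ x = t * d x from congrFun hsub x, hd, abs_mul, abs_mul, abs_of_pos htpos,
      abs_of_pos (hμ.1 x)]
    have : t * |f x| ≤ δ := by
      rw [ht, div_mul_eq_mul_div, div_le_iff₀ hCpos]
      exact mul_le_mul_of_nonneg_left (hfC x) hδ0.le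
    nlinarith [hμ.1 x]
  have hν : IsDist ν := by
    refine ⟨fun x => ?_, ?_⟩
    · have := neg_le_of_abs_le (hclose x)
      nlinarith [hμ.1 x]
    · rw [hνdef, sum_add_distrib, ← mul_sum, hf0, hμ.2]; ring
  have hB := integral_weight_add_pos hβ hnontriv
  have hlow := le_fDiv_of_abs_sub_le hβ hrep (hμ.push hK hKpos) (hν.push hK) hδ0.le
    (abs_push_sub_le hK hclose)
  have hpos := le_fDiv_of_abs_sub_le hβ hrep hμ hν hδ0.le hclose
  have hup := fDiv_le_of_abs_sub_le hβ hrep hμ hν hδ0.le hδ hclose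
  rw [hsubK, chiSq_smul] at hlow
  rw [hsub, chiSq_smul, hQ1, mul_one] at hpos hup
  set B := β + ∫ l in Set.Ioo (0:ℝ) 1, l ^ 2 * (1 - l) ∂Υ
  have hD : 0 < fDiv Φ ν μ := lt_of_lt_of_le (by positivity) hpos
  have hne : ν ≠ μ := by
    intro h
    have hz : ∀ x, d x = 0 := fun x => by
      have := congrFun hsub x
      rw [h, sub_self] at this
      exact (mul_eq_zero.1 this.symm).resolve_left htpos.ne'
    simp [chiSq, hz] at hQ1
  have hratio := fDiv_ratio_le_eta hβ hrep hK hKpos hμ hν hne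
  rw [div_le_iff₀ hD] at hratio
  have heta := eta_nonneg hβ hrep hK hKpos hμ
  have h1 : (1 + δ)⁻¹ * (B * (t ^ 2 * chiSq (push μ K) (push d K)))
      ≤ eta Φ μ K * ((1 - δ)⁻¹ * (B * t ^ 2)) :=
    hlow.trans (hratio.trans (mul_le_mul_of_nonneg_left hup heta))
  have hδ' : 0 < 1 - δ := by linarith
  have hBt : 0 < B * t ^ 2 := by positivity
  have h2 : (1 + δ)⁻¹ * chiSq (push μ K) (push d K) ≤ eta Φ μ K * (1 - δ)⁻¹ := by
    refine le_of_mul_le_mul_right ?_ hBt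
    calc _ = _ := by ring
      _ ≤ _ := h1
      _ = _ := by ring
  rw [← div_eq_mul_inv, inv_mul_eq_div, div_le_div_iff₀ (by linarith) hδ'] at h2
  linarith

lemma maxCorr_sq_le_eta (hβ : 0 ≤ β)
    (hrep : ∀ u : ℝ, 0 ≤ u →
      Φ u = β * u ^ 2 - (∫ l in Set.Ioo (0:ℝ) 1, l * u / (l * u + 1 - l) ∂Υ) + a * u + b)
    (hnontriv : 0 < β ∨ 0 < Υ (Set.Ioo (0:ℝ) 1))
    (hK : IsChannel K) (hKpos : ∀ y : Y, ∃ x : X, 0 < K x y)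
    {μ : X → ℝ} (hμ : IsPosDist μ) : maxCorr μ K ^ 2 ≤ eta Φ μ K := by
  suffices h : maxCorr μ K ≤ √(eta Φ μ K) from
    (pow_le_pow_left₀ (maxCorr_nonneg hμ hK) h 2).trans_eq
      (Real.sq_sqrt (eta_nonneg hβ hrep hK hKpos hμ))
  refine Real.sSup_le ?_ (Real.sqrt_nonneg _)
  rintro r ⟨f, g, hf0, -, hf1, hg1, rfl⟩
  refine Real.le_sqrt_of_sq_le
    ((sq_corr_le_chiSq_push (hμ.push hK hKpos).1 f hg1).trans ?_)
  have hlim : ∀ c : ℝ, ∀ q : ℝ, Filter.Tendsto (fun δ : ℝ => (1 + c * δ) * q)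
      (nhdsWithin 0 (Set.Ioi 0)) (nhds q) := by
    intro c q
    have : Continuous fun δ : ℝ => (1 + c * δ) * q := by fun_prop
    simpa using (this.tendsto 0).mono_left nhdsWithin_le_nhds
  refine le_of_tendsto_of_tendsto (hlim (-1) _) (hlim 1 _) ?_
  filter_upwards [Ioo_mem_nhdsGT (zero_lt_one' ℝ)] with δ hδ
  have := chiSq_push_le_eta_of_lt_one hβ hrep hnontriv hK hKpos hμ hf0 hf1 hδ.1 hδ.2
  rwa [neg_one_mul, one_mul, ← sub_eq_add_neg]

end Eta

/-- Theorem (Choi–Ruskai–Seneta): if convex `Φ` admits a nontrivial Loewner-type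
representation `Φ(u) = βu² − ∫_{(0,1)} λu/(λu+1−λ) Υ(dλ) + au + b` (with `β > 0` or
`Υ((0,1)) > 0`), then for any channel `K` between finite alphabets with `|X| ≥ 2` whose
every output symbol is reachable, `η_Φ(K) = S²(K)`, where
`S²(K) = sup_μ S(μ,K)²` over strictly positive input distributions `μ`. -/
theorem statement5 {X Y : Type} [Fintype X] [Fintype Y] [Nonempty X] [Nonempty Y]
    (Φ : ℝ → ℝ) (hconv : ConvexOn ℝ (Set.Ici 0) Φ)
    (β a b : ℝ) (hβ : 0 ≤ β)
    (Υ : MeasureTheory.Measure ℝ) [MeasureTheory.IsFiniteMeasure Υ]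
    (hsupp : Υ (Set.Ioo (0:ℝ) 1)ᶜ = 0)
    (hrep : ∀ u : ℝ, 0 ≤ u →
      Φ u = β * u ^ 2 - (∫ l in Set.Ioo (0:ℝ) 1, l * u / (l * u + 1 - l) ∂Υ)
        + a * u + b)
    (hnontriv : 0 < β ∨ 0 < Υ (Set.Ioo (0:ℝ) 1))
    (hX : 2 ≤ Fintype.card X)
    (K : X → Y → ℝ) (hK : IsChannel K) (hKpos : ∀ y : Y, ∃ x : X, 0 < K x y) :
    etaSup Φ K = sSup { r | ∃ μ : X → ℝ, IsPosDist μ ∧ r = (maxCorr μ K) ^ 2 } := by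
  have hS : ∀ m : X → ℝ, IsPosDist m →
      maxCorr m K ^ 2 ≤ sSup { r | ∃ μ : X → ℝ, IsPosDist μ ∧ r = (maxCorr μ K) ^ 2 } :=
    fun m hm => le_csSup (bddAbove_maxCorr_sq hK) ⟨m, hm, rfl⟩
  apply le_antisymm
  · refine Real.sSup_le ?_ (Real.sSup_nonneg ?_)
    · rintro r ⟨μ, hμ, rfl⟩
      exact eta_le hβ hrep hK hKpos hμ hS
    · rintro r ⟨μ, -, rfl⟩
      exact sq_nonneg _
  · refine Real.sSup_le ?_ (Real.sSup_nonneg ?_)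
    · rintro r ⟨μ, hμ, rfl⟩
      refine (maxCorr_sq_le_eta hβ hrep hnontriv hK hKpos hμ).trans
        (le_csSup ⟨1, ?_⟩ ⟨μ, hμ, rfl⟩)
      rintro r ⟨μ', hμ', rfl⟩
      exact eta_le hβ hrep hK hKpos hμ' fun m hm => maxCorr_sq_le_one hm hK
    · rintro r ⟨μ, hμ, rfl⟩
      exact eta_nonneg hβ hrep hK hKpos hμ

end SDPI
end
end

section
/- Suppose Φ : [0,∞) → ℝ is convex and induces a Φ-entropy that is both subadditive and homogeneous. Let (μᵢ,Kᵢ), i = 1,…,n, be admissible pairs, with μᵢ a strictly positive distribution on a finite set Xᵢ and Kᵢ a channel from Xᵢ to a finite set Yᵢ. Then η_Φ(μ₁⊗⋯⊗μₙ, K₁⊗⋯⊗Kₙ) = max_{1 ≤ i ≤ n} η_Φ(μᵢ,Kᵢ), where (μ₁⊗⋯⊗μₙ)(x₁,…,xₙ) = Π μᵢ(xᵢ) and (K₁⊗⋯⊗Kₙ)(y₁,…,yₙ|x₁,…,xₙ) = Π Kᵢ(yᵢ|xᵢ). -/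
open Finset

noncomputable section

namespace SDPI

variable {X Y : Type} [Fintype X] [Fintype Y]

set_option linter.unusedSectionVars false

/-- `η` is a contraction constant for the `Φ`-entropy along the pair `(μ, K)`. -/
def Contracts (Φ : ℝ → ℝ) (μ : X → ℝ) (K : X → Y → ℝ) (η : ℝ) : Prop :=
  ∀ f : X → ℝ, (∀ x, 0 ≤ f x) → Ent Φ (push μ K) (condExp μ K f) ≤ η * Ent Φ μ f

theorem IsPosDist.isDist {μ : X → ℝ} (h : IsPosDist μ) : IsDist μ :=
  ⟨fun x => (h.1 x).le, h.2⟩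

theorem sum_push_mul_condExp {μ : X → ℝ} {K : X → Y → ℝ} (hK : IsChannel K)
    (hp : ∀ y, 0 < push μ K y) (f : X → ℝ) :
    ∑ y, push μ K y * condExp μ K f y = ∑ x, μ x * f x := by
  have h : ∀ y, push μ K y * condExp μ K f y = ∑ x, μ x * K x y * f x := fun y =>
    mul_div_cancel₀ _ (hp y).ne'
  simp_rw [h]
  rw [Finset.sum_comm]
  refine Finset.sum_congr rfl fun x _ => ?_
  calc ∑ y, μ x * K x y * f x = (μ x * f x) * ∑ y, K x y := by
        rw [Finset.mul_sum]; exact Finset.sum_congr rfl fun y _ => by ring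
    _ = μ x * f x := by rw [hK.2, mul_one]

theorem isPosDist_push {μ : X → ℝ} {K : X → Y → ℝ} (hμ : IsPosDist μ) (hK : IsChannel K)
    (hp : ∀ y, 0 < push μ K y) : IsPosDist (push μ K) := by
  refine ⟨hp, ?_⟩
  simp only [push]
  rw [Finset.sum_comm]
  simp_rw [← Finset.mul_sum, hK.2, mul_one, hμ.2]

theorem condExp_nonneg {μ : X → ℝ} {K : X → Y → ℝ} (hμ : IsPosDist μ) (hK : IsChannel K)
    (hp : ∀ y, 0 < push μ K y) {f : X → ℝ} (hf : ∀ x, 0 ≤ f x) (y : Y) :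
    0 ≤ condExp μ K f y :=
  div_nonneg (Finset.sum_nonneg fun x _ =>
    mul_nonneg (mul_nonneg (hμ.1 x).le (hK.1 x y)) (hf x)) (hp y).le

theorem condExp_const {μ : X → ℝ} {K : X → Y → ℝ} (hp : ∀ y, 0 < push μ K y) (c : ℝ) :
    condExp μ K (fun _ => c) = fun _ => c := by
  funext y
  rw [condExp, ← Finset.sum_mul, div_eq_iff (hp y).ne', mul_comm]
  rfl

theorem condExp_smul (μ : X → ℝ) (K : X → Y → ℝ) (c : ℝ) (f : X → ℝ) :
    condExp μ K (fun x => c * f x) = fun y => c * condExp μ K f y := by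
  funext y
  rw [condExp, condExp, mul_div_assoc', Finset.mul_sum]
  congr 1
  exact Finset.sum_congr rfl fun x _ => by ring

theorem Ent_const (Φ : ℝ → ℝ) {μ : X → ℝ} (hμ : IsDist μ) (c : ℝ) :
    Ent Φ μ (fun _ => c) = 0 := by
  rw [Ent, ← Finset.sum_mul, ← Finset.sum_mul, hμ.2, one_mul, one_mul, sub_self]

theorem Ent_nonneg {Φ : ℝ → ℝ} (hconv : ConvexOn ℝ (Set.Ici 0) Φ) {μ : X → ℝ} (hμ : IsDist μ)
    {f : X → ℝ} (hf : ∀ x, 0 ≤ f x) : 0 ≤ Ent Φ μ f := by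
  have h := hconv.map_sum_le (t := Finset.univ) (w := μ) (p := f)
    (fun x _ => hμ.1 x) hμ.2 (fun x _ => hf x)
  simp only [smul_eq_mul] at h
  exact sub_nonneg.mpr h

/-- The data processing inequality. -/
theorem contracts_one {Φ : ℝ → ℝ} (hconv : ConvexOn ℝ (Set.Ici 0) Φ) {μ : X → ℝ}
    {K : X → Y → ℝ} (hμ : IsPosDist μ) (hK : IsChannel K) (hp : ∀ y, 0 < push μ K y) :
    Contracts Φ μ K 1 := by
  intro f hf
  rw [one_mul, Ent, Ent, sum_push_mul_condExp hK hp]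
  refine sub_le_sub_right ?_ _
  rw [← sum_push_mul_condExp hK hp]
  refine Finset.sum_le_sum fun y _ => mul_le_mul_of_nonneg_left ?_ (hp y).le
  have h := hconv.map_sum_le (t := Finset.univ) (w := fun x => μ x * K x y / push μ K y) (p := f)
    (fun x _ => div_nonneg (mul_nonneg (hμ.1 x).le (hK.1 x y)) (hp y).le)
    (by rw [← Finset.sum_div]; exact div_self (hp y).ne') (fun x _ => hf x)
  simp only [smul_eq_mul, div_mul_eq_mul_div, ← Finset.sum_div] at h
  exact h

theorem condExp_div {μ : X → ℝ} (hμ : IsPosDist μ) (K : X → Y → ℝ) (ν : X → ℝ) :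
    condExp μ K (fun x => ν x / μ x) = fun y => push ν K y / push μ K y := by
  funext y
  rw [condExp]
  congr 1
  refine Finset.sum_congr rfl fun x _ => ?_
  have := (hμ.1 x).ne'
  field_simp

theorem fDiv_eq_Ent (Φ : ℝ → ℝ) {μ ν : X → ℝ} (hμ : IsPosDist μ) (hν : ∑ x, ν x = 1) :
    fDiv Φ ν μ = Ent Φ μ (fun x => ν x / μ x) := by
  have h : ∀ x, μ x * (ν x / μ x) = ν x := fun x => mul_div_cancel₀ _ (hμ.1 x).ne'
  simp only [fDiv, Ent, h, hν]

theorem fDiv_push_eq_Ent (Φ : ℝ → ℝ) {μ ν : X → ℝ} {K : X → Y → ℝ} (hμ : IsPosDist μ)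
    (hK : IsChannel K) (hp : ∀ y, 0 < push μ K y) (hν : ∑ x, ν x = 1) :
    fDiv Φ (push ν K) (push μ K) = Ent Φ (push μ K) (condExp μ K fun x => ν x / μ x) := by
  rw [condExp_div hμ, fDiv_eq_Ent Φ (isPosDist_push hμ hK hp)]
  simp only [push]
  rw [Finset.sum_comm]
  simp_rw [← Finset.mul_sum, hK.2, mul_one, hν]

theorem fDiv_ratio_le_s8 {Φ : ℝ → ℝ} (hconv : ConvexOn ℝ (Set.Ici 0) Φ) {μ ν : X → ℝ}
    {K : X → Y → ℝ} (hμ : IsPosDist μ) (hK : IsChannel K) (hp : ∀ y, 0 < push μ K y)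
    {η : ℝ} (hη : 0 ≤ η) (h : Contracts Φ μ K η) (hν : IsDist ν) :
    fDiv Φ (push ν K) (push μ K) / fDiv Φ ν μ ≤ η := by
  have hf : ∀ x, 0 ≤ ν x / μ x := fun x => div_nonneg (hν.1 x) (hμ.1 x).le
  rw [fDiv_push_eq_Ent Φ hμ hK hp hν.2, fDiv_eq_Ent Φ hμ hν.2]
  exact div_le_of_le_mul₀ (Ent_nonneg hconv hμ.isDist hf) hη (h _ hf)

theorem eta_le_s8 {Φ : ℝ → ℝ} (hconv : ConvexOn ℝ (Set.Ici 0) Φ) {μ : X → ℝ}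
    {K : X → Y → ℝ} (hμ : IsPosDist μ) (hK : IsChannel K) (hp : ∀ y, 0 < push μ K y)
    {η : ℝ} (hη : 0 ≤ η) (h : Contracts Φ μ K η) : eta Φ μ K ≤ η := by
  refine Real.sSup_le ?_ hη
  rintro r ⟨ν, hν, -, rfl⟩
  exact fDiv_ratio_le_s8 hconv hμ hK hp hη h hν

theorem eta_nonneg_s8 {Φ : ℝ → ℝ} (hconv : ConvexOn ℝ (Set.Ici 0) Φ) {μ : X → ℝ}
    {K : X → Y → ℝ} (hμ : IsPosDist μ) (hK : IsChannel K) (hp : ∀ y, 0 < push μ K y) :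
    0 ≤ eta Φ μ K := by
  refine Real.sSup_nonneg ?_
  rintro r ⟨ν, hν, -, rfl⟩
  have hf : ∀ x, 0 ≤ ν x / μ x := fun x => div_nonneg (hν.1 x) (hμ.1 x).le
  rw [fDiv_push_eq_Ent Φ hμ hK hp hν.2, fDiv_eq_Ent Φ hμ hν.2]
  exact div_nonneg (Ent_nonneg hconv (isPosDist_push hμ hK hp).isDist
    (condExp_nonneg hμ hK hp hf)) (Ent_nonneg hconv hμ.isDist hf)

theorem contracts_eta {Φ : ℝ → ℝ} (hconv : ConvexOn ℝ (Set.Ici 0) Φ) (hhom : Homogeneous Φ)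
    {μ : X → ℝ} {K : X → Y → ℝ} (hμ : IsPosDist μ) (hK : IsChannel K)
    (hp : ∀ y, 0 < push μ K y) : Contracts Φ μ K (eta Φ μ K) := by
  have hπ := isPosDist_push hμ hK hp
  intro f hf
  by_cases hc : ∃ c : ℝ, f = fun _ => c
  · obtain ⟨c, rfl⟩ := hc
    rw [condExp_const hp, Ent_const Φ hπ.isDist, Ent_const Φ hμ.isDist, mul_zero]
  obtain ⟨κ, hκ, hE⟩ := hhom
  set m := ∑ x, μ x * f x with hm
  have hmf : ∀ x ∈ Finset.univ, 0 ≤ μ x * f x := fun x _ => mul_nonneg (hμ.1 x).le (hf x)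
  have hm0 : 0 < m := by
    refine lt_of_le_of_ne (Finset.sum_nonneg hmf) fun h => hc ⟨0, ?_⟩
    funext x
    have := (Finset.sum_eq_zero_iff_of_nonneg hmf).mp h.symm x (Finset.mem_univ x)
    exact (mul_eq_zero.mp this).resolve_left (hμ.1 x).ne'
  set ν : X → ℝ := fun x => μ x * f x / m with hνdef
  have hν : IsDist ν :=
    ⟨fun x => div_nonneg (hmf x (Finset.mem_univ x)) hm0.le, by
      rw [hνdef, ← Finset.sum_div]; exact div_self hm0.ne'⟩
  have hνμ : ν ≠ μ := by
    refine fun h => hc ⟨m, ?_⟩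
    funext x
    have h1 : μ x * f x / m = μ x := congrFun h x
    rw [div_eq_iff hm0.ne'] at h1
    exact mul_left_cancel₀ (hμ.1 x).ne' h1
  set g : X → ℝ := fun x => ν x / μ x with hg
  have hg0 : ∀ x, 0 ≤ g x := fun x => div_nonneg (hν.1 x) (hμ.1 x).le
  have hfg : f = fun x => m * g x := by
    funext x
    have := (hμ.1 x).ne'
    simp only [hg, hνdef]
    field_simp
  have hbdd : BddAbove { r | ∃ ν : X → ℝ, IsDist ν ∧ ν ≠ μ ∧
      r = fDiv Φ (push ν K) (push μ K) / fDiv Φ ν μ } := by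
    refine ⟨1, ?_⟩
    rintro r ⟨ν, hν, -, rfl⟩
    exact fDiv_ratio_le_s8 hconv hμ hK hp zero_le_one (contracts_one hconv hμ hK hp) hν
  have hle : fDiv Φ (push ν K) (push μ K) / fDiv Φ ν μ ≤ eta Φ μ K :=
    le_csSup hbdd ⟨ν, hν, hνμ, rfl⟩
  rw [fDiv_push_eq_Ent Φ hμ hK hp hν.2, fDiv_eq_Ent Φ hμ hν.2] at hle
  have key : Ent Φ (push μ K) (condExp μ K g) ≤ eta Φ μ K * Ent Φ μ g := by
    rcases (Ent_nonneg hconv hμ.isDist hg0).eq_or_lt with h0 | h0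
    · have := contracts_one hconv hμ hK hp g hg0
      rwa [← h0, mul_zero] at this ⊢
    · exact (div_le_iff₀ h0).mp hle
  rw [hfg, condExp_smul, hE m hm0 Y _ hπ.isDist _ (condExp_nonneg hμ hK hp hg0),
    hE m hm0 X _ hμ.isDist _ hg0, mul_left_comm]
  exact mul_le_mul_of_nonneg_left key (hκ m hm0).le

theorem Contracts.mono {Φ : ℝ → ℝ} (hconv : ConvexOn ℝ (Set.Ici 0) Φ) {μ : X → ℝ}
    {K : X → Y → ℝ} (hμ : IsPosDist μ) {η η' : ℝ} (hle : η ≤ η') (h : Contracts Φ μ K η) :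
    Contracts Φ μ K η' := fun f hf =>
  (h f hf).trans (mul_le_mul_of_nonneg_right hle (Ent_nonneg hconv hμ.isDist hf))

section Product

variable {X₁ X₂ Y₁ Y₂ : Type} [Fintype X₁] [Fintype X₂] [Fintype Y₁] [Fintype Y₂]

/-- The chain rule for the `Φ`-entropy. -/
theorem Ent_prod (Φ : ℝ → ℝ) (μ : X₁ → ℝ) (ν : X₂ → ℝ) (f : X₁ × X₂ → ℝ) :
    Ent Φ (fun p : X₁ × X₂ => μ p.1 * ν p.2) f =
      ∑ x, μ x * Ent Φ ν (fun y => f (x, y)) + Ent Φ μ (fun x => ∑ y, ν y * f (x, y)) := by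
  simp only [Ent, Fintype.sum_prod_type, mul_sub, Finset.sum_sub_distrib, Finset.mul_sum,
    mul_assoc]
  ring

theorem Ent_prod_swap (Φ : ℝ → ℝ) (μ : X₁ → ℝ) (ν : X₂ → ℝ) (f : X₁ × X₂ → ℝ) :
    Ent Φ (fun p : X₁ × X₂ => μ p.1 * ν p.2) f =
      ∑ y, ν y * Ent Φ μ (fun x => f (x, y)) + Ent Φ ν (fun y => ∑ x, μ x * f (x, y)) := by
  simp only [Ent, Fintype.sum_prod_type_right, mul_sub, Finset.sum_sub_distrib, Finset.mul_sum,
    mul_assoc, mul_left_comm]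
  ring

/-- A binary family of types, indexed by `Fin 2`. -/
def pairType (A B : Type) : Fin 2 → Type
  | 0 => A
  | 1 => B

instance pairTypeFintype (A B : Type) [Fintype A] [Fintype B] :
    ∀ i, Fintype (pairType A B i)
  | 0 => inferInstanceAs (Fintype A)
  | 1 => inferInstanceAs (Fintype B)

/-- The dependent pair of functions over `pairType`. -/
def pairFun {A B : Type} (μ : A → ℝ) (ν : B → ℝ) : ∀ i, pairType A B i → ℝ
  | 0 => μ
  | 1 => ν

theorem sum_pi_pairType {A B : Type} [Fintype A] [Fintype B]
    (F : (∀ i, pairType A B i) → ℝ) :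
    ∑ z, F z = ∑ a : A, ∑ b : B, F ((piFinTwoEquiv (pairType A B)).symm (a, b)) := by
  rw [← Fintype.sum_prod_type' (f := fun (a : A) (b : B) =>
    F ((piFinTwoEquiv (pairType A B)).symm (a, b)))]
  exact (Equiv.sum_comp (piFinTwoEquiv (pairType A B)).symm F).symm

/-- Subadditivity with two factors, as superadditivity of the entropies of the marginals. -/
theorem Ent_marginals_le {Φ : ℝ → ℝ} (hsub : Subadditive Φ) {μ : X₁ → ℝ} {ν : X₂ → ℝ}
    (hμ : IsDist μ) (hν : IsDist ν) {f : X₁ × X₂ → ℝ} (hf : ∀ p, 0 ≤ f p) :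
    Ent Φ μ (fun x => ∑ y, ν y * f (x, y)) + Ent Φ ν (fun y => ∑ x, μ x * f (x, y)) ≤
      Ent Φ (fun p : X₁ × X₂ => μ p.1 * ν p.2) f := by
  have h := hsub 2 (pairType X₁ X₂) (pairFun μ ν)
    (fun i => match i with
      | 0 => hμ
      | 1 => hν)
    (fun z => f (z 0, z 1)) (fun z => hf _)
  simp only [Ent, sum_pi_pairType, Fin.prod_univ_two, Fin.sum_univ_two] at h
  have h' : ∑ a, ∑ b, μ a * ν b * Φ (f (a, b)) - Φ (∑ a, ∑ b, μ a * ν b * f (a, b)) ≤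
      (∑ a, ∑ b, μ a * ν b * Φ (f (a, b)) -
        ∑ a, ∑ b, μ a * ν b * Φ (∑ w, μ w * f (w, b))) +
      (∑ a, ∑ b, μ a * ν b * Φ (f (a, b)) -
        ∑ a, ∑ b, μ a * ν b * Φ (∑ w, ν w * f (a, w))) := h
  have e1 : ∑ a, ∑ b, μ a * ν b * Φ (∑ w, μ w * f (w, b)) =
      ∑ b, ν b * Φ (∑ w, μ w * f (w, b)) := by
    simp_rw [mul_assoc, ← Finset.mul_sum]
    rw [← Finset.sum_mul, hμ.2, one_mul]
  have e2 : ∑ a, ∑ b, μ a * ν b * Φ (∑ w, ν w * f (a, w)) =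
      ∑ a, μ a * Φ (∑ w, ν w * f (a, w)) := by
    simp_rw [← Finset.sum_mul, ← Finset.mul_sum, hν.2, mul_one]
  have e3 : ∑ a, μ a * ∑ b, ν b * f (a, b) = ∑ a, ∑ b, μ a * ν b * f (a, b) := by
    simp_rw [Finset.mul_sum, mul_assoc]
  have e4 : ∑ b, ν b * ∑ a, μ a * f (a, b) = ∑ a, ∑ b, μ a * ν b * f (a, b) := by
    rw [Finset.sum_comm]
    simp_rw [Finset.mul_sum, mul_assoc, mul_left_comm]
  simp only [Ent, Fintype.sum_prod_type, e3, e4]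
  rw [e1, e2] at h'
  linarith

theorem push_prod (μ : X₁ → ℝ) (ν : X₂ → ℝ) (K : X₁ → Y₁ → ℝ) (L : X₂ → Y₂ → ℝ) :
    push (fun p : X₁ × X₂ => μ p.1 * ν p.2) (fun p (q : Y₁ × Y₂) => K p.1 q.1 * L p.2 q.2) =
      fun q => push μ K q.1 * push ν L q.2 := by
  funext q
  simp only [push, Fintype.sum_prod_type, Finset.sum_mul_sum]
  exact Finset.sum_congr rfl fun x _ => Finset.sum_congr rfl fun y _ => by ring

theorem condExp_prod (μ : X₁ → ℝ) (ν : X₂ → ℝ) (K : X₁ → Y₁ → ℝ) (L : X₂ → Y₂ → ℝ)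
    (f : X₁ × X₂ → ℝ) :
    condExp (fun p : X₁ × X₂ => μ p.1 * ν p.2) (fun p (q : Y₁ × Y₂) => K p.1 q.1 * L p.2 q.2) f =
      fun q => condExp ν L (fun b => condExp μ K (fun a => f (a, b)) q.1) q.2 := by
  funext q
  rw [condExp, push_prod]
  simp only [condExp, Fintype.sum_prod_type_right, mul_div_assoc', ← Finset.sum_div, div_div,
    Finset.mul_sum]
  congr 1
  exact Finset.sum_congr rfl fun x _ => Finset.sum_congr rfl fun y _ => by ring

theorem sum_mul_condExp (μ : X₁ → ℝ) (ν : X₂ → ℝ) (K : X₁ → Y₁ → ℝ) (f : X₁ × X₂ → ℝ) (y : Y₁) :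
    ∑ b, ν b * condExp μ K (fun a => f (a, b)) y =
      condExp μ K (fun a => ∑ b, ν b * f (a, b)) y := by
  simp only [condExp, mul_div_assoc', ← Finset.sum_div, Finset.mul_sum]
  rw [Finset.sum_comm]
  congr 1
  exact Finset.sum_congr rfl fun x _ => Finset.sum_congr rfl fun y _ => by ring

theorem sum_mul_le_mul_sum {w a b : X → ℝ} {η : ℝ} (hw : ∀ x, 0 ≤ w x)
    (h : ∀ x, a x ≤ η * b x) : ∑ x, w x * a x ≤ η * ∑ x, w x * b x := by
  rw [Finset.mul_sum]
  refine Finset.sum_le_sum fun x _ => ?_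
  rw [mul_left_comm]
  exact mul_le_mul_of_nonneg_left (h x) (hw x)

theorem contraction_arith {η A B C D E F P Q R S : ℝ} (e1 : A = P + B) (e2 : C = Q + B)
    (e3 : C = R + D) (e4 : E = S + D) (i1 : P ≤ η * Q) (i2 : R ≤ η * S) (i3 : B ≤ η * F)
    (i4 : F + D ≤ E) (h0 : 0 ≤ η) (h1 : η ≤ 1) : A ≤ η * E := by
  have h2 := sub_nonneg.mpr h1
  linear_combination e1 + η * (e3 - e2) - η ^ 2 * e4 + i1 + η * i2 + (1 - η) * i3 +
    η * (1 - η) * i4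

theorem Contracts.prod {Φ : ℝ → ℝ} (hsub : Subadditive Φ) {μ : X₁ → ℝ} {ν : X₂ → ℝ}
    {K : X₁ → Y₁ → ℝ} {L : X₂ → Y₂ → ℝ} (hμ : IsPosDist μ) (hν : IsPosDist ν)
    (hK : IsChannel K) (hL : IsChannel L) (hpK : ∀ y, 0 < push μ K y)
    (hpL : ∀ y, 0 < push ν L y) {η : ℝ} (h0 : 0 ≤ η) (h1 : η ≤ 1)
    (hcK : Contracts Φ μ K η) (hcL : Contracts Φ ν L η) :
    Contracts Φ (fun p : X₁ × X₂ => μ p.1 * ν p.2)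
      (fun p (q : Y₁ × Y₂) => K p.1 q.1 * L p.2 q.2) η := by
  intro f hf
  rw [push_prod, condExp_prod]
  set h : Y₁ × X₂ → ℝ := fun p => condExp μ K (fun a => f (a, p.2)) p.1 with hh
  have hh0 : ∀ p, 0 ≤ h p := fun p => condExp_nonneg hμ hK hpK (fun a => hf _) _
  have e1 := Ent_prod Φ (push μ K) (push ν L)
    (fun q => condExp ν L (fun b => h (q.1, b)) q.2)
  have e2 := Ent_prod Φ (push μ K) ν h
  have e3 := Ent_prod_swap Φ (push μ K) ν h
  have e4 := Ent_prod_swap Φ μ ν f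
  simp only [sum_push_mul_condExp hL hpL] at e1
  have hA : (fun y => ∑ b, ν b * h (y, b)) = condExp μ K (fun a => ∑ b, ν b * f (a, b)) := by
    funext y
    exact sum_mul_condExp μ ν K f y
  have hC : (fun b => ∑ y, push μ K y * h (y, b)) = fun b => ∑ a, μ a * f (a, b) := by
    funext b
    exact sum_push_mul_condExp hK hpK fun a => f (a, b)
  rw [hA] at e1 e2
  rw [hC] at e3
  have i1 : ∑ y, push μ K y * Ent Φ (push ν L) (condExp ν L fun b => h (y, b)) ≤
      η * ∑ y, push μ K y * Ent Φ ν (fun b => h (y, b)) :=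
    sum_mul_le_mul_sum (fun y => (hpK y).le) fun y => hcL (fun b => h (y, b)) fun b => hh0 (y, b)
  have i2 : ∑ b, ν b * Ent Φ (push μ K) (fun y => h (y, b)) ≤
      η * ∑ b, ν b * Ent Φ μ (fun a => f (a, b)) :=
    sum_mul_le_mul_sum (fun b => (hν.1 b).le) fun b => hcK (fun a => f (a, b)) fun a => hf (a, b)
  have i3 := hcK (fun a => ∑ b, ν b * f (a, b))
    (fun a => Finset.sum_nonneg fun b _ => mul_nonneg (hν.1 b).le (hf _))
  have i4 := Ent_marginals_le hsub hμ.isDist hν.isDist hf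
  exact contraction_arith e1 e2 e3 e4 i1 i2 i3 i4 h0 h1

end Product

theorem Contracts.of_equiv {X' Y' : Type} [Fintype X'] [Fintype Y'] {Φ : ℝ → ℝ} {μ : X → ℝ}
    {K : X → Y → ℝ} (e : X' ≃ X) (e' : Y' ≃ Y) {η : ℝ}
    (h : Contracts Φ (fun x => μ (e x)) (fun x y => K (e x) (e' y)) η) :
    Contracts Φ μ K η := by
  intro f hf
  have h1 := h (fun x => f (e x)) fun x => hf _
  have hpush : push (fun x => μ (e x)) (fun x y => K (e x) (e' y)) =
      fun y => push μ K (e' y) := by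
    funext y
    exact Equiv.sum_comp e fun x => μ x * K x (e' y)
  have hcond : condExp (fun x => μ (e x)) (fun x y => K (e x) (e' y)) (fun x => f (e x)) =
      fun y => condExp μ K f (e' y) := by
    funext y
    rw [condExp, hpush, Equiv.sum_comp e fun x => μ x * K x (e' y) * f x]
    rfl
  have hEnt : ∀ {A B : Type} [Fintype A] [Fintype B] (u : A ≃ B) (p g : B → ℝ),
      Ent Φ (fun a => p (u a)) (fun a => g (u a)) = Ent Φ p g := by
    intro A B _ _ u p g
    rw [Ent, Ent, Equiv.sum_comp u fun b => p b * Φ (g b), Equiv.sum_comp u fun b => p b * g b]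
  rwa [hpush, hcond, hEnt, hEnt] at h1

section Pi

variable {ι : Type} [Fintype ι] [DecidableEq ι] {Xs Ys : ι → Type} [∀ i, Fintype (Xs i)]
  [∀ i, Fintype (Ys i)]

theorem isPosDist_pi {μ : ∀ i, Xs i → ℝ} (hμ : ∀ i, IsPosDist (μ i)) :
    IsPosDist (fun x : ∀ i, Xs i => ∏ i, μ i (x i)) := by
  refine ⟨fun x => Finset.prod_pos fun i _ => (hμ i).1 _, ?_⟩
  rw [← Fintype.prod_sum]
  exact Finset.prod_eq_one fun i _ => (hμ i).2

theorem isChannel_pi {K : ∀ i, Xs i → Ys i → ℝ} (hK : ∀ i, IsChannel (K i)) :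
    IsChannel (fun (x : ∀ i, Xs i) (y : ∀ i, Ys i) => ∏ i, K i (x i) (y i)) := by
  refine ⟨fun x y => Finset.prod_nonneg fun i _ => (hK i).1 _ _, fun x => ?_⟩
  rw [← Fintype.prod_sum fun i y => K i (x i) y]
  exact Finset.prod_eq_one fun i _ => (hK i).2 _

theorem push_pi (μ : ∀ i, Xs i → ℝ) (K : ∀ i, Xs i → Ys i → ℝ) :
    push (fun x : ∀ i, Xs i => ∏ i, μ i (x i))
        (fun (x : ∀ i, Xs i) (y : ∀ i, Ys i) => ∏ i, K i (x i) (y i)) =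
      fun y => ∏ i, push (μ i) (K i) (y i) := by
  funext y
  simp only [push, ← Finset.prod_mul_distrib]
  rw [Fintype.prod_sum fun i x => μ i x * K i x (y i)]

theorem sum_pi_mul_apply (w : ∀ i, Xs i → ℝ) (i : ι) (g : Xs i → ℝ) :
    ∑ x : ∀ j, Xs j, (∏ j, w j (x j)) * g (x i) =
      (∑ a, w i a * g a) * ∏ j ∈ Finset.univ.erase i, ∑ a, w j a := by
  set v : ∀ j, Xs j → ℝ := Function.update w i fun a => w i a * g a with hv
  have h1 : ∀ x : ∀ j, Xs j, (∏ j, w j (x j)) * g (x i) = ∏ j, v j (x j) := by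
    intro x
    rw [← Finset.mul_prod_erase _ _ (Finset.mem_univ i),
      ← Finset.mul_prod_erase _ (fun j => v j (x j)) (Finset.mem_univ i)]
    have : ∏ j ∈ Finset.univ.erase i, v j (x j) = ∏ j ∈ Finset.univ.erase i, w j (x j) :=
      Finset.prod_congr rfl fun j hj => by
        rw [hv, Function.update_of_ne (Finset.ne_of_mem_erase hj)]
    rw [this, hv, Function.update_self]
    ring
  simp_rw [h1]
  rw [← Fintype.prod_sum, ← Finset.mul_prod_erase _ _ (Finset.mem_univ i), hv,
    Function.update_self]
  congr 1
  exact Finset.prod_congr rfl fun j hj => by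
    rw [Function.update_of_ne (Finset.ne_of_mem_erase hj)]

theorem sum_pi_dist_mul_apply {μ : ∀ i, Xs i → ℝ} (hμ : ∀ i, IsPosDist (μ i)) (i : ι)
    (g : Xs i → ℝ) :
    ∑ x : ∀ j, Xs j, (∏ j, μ j (x j)) * g (x i) = ∑ a, μ i a * g a := by
  rw [sum_pi_mul_apply, Finset.prod_eq_one fun j _ => (hμ j).2, mul_one]

theorem Ent_pi_apply (Φ : ℝ → ℝ) {μ : ∀ i, Xs i → ℝ} (hμ : ∀ i, IsPosDist (μ i)) (i : ι)
    (f : Xs i → ℝ) :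
    Ent Φ (fun x : ∀ i, Xs i => ∏ i, μ i (x i)) (fun x => f (x i)) = Ent Φ (μ i) f := by
  rw [Ent, Ent, sum_pi_dist_mul_apply hμ i f, sum_pi_dist_mul_apply hμ i fun a => Φ (f a)]

/-- A contraction constant of a product is one of each factor. -/
theorem Contracts.of_pi {Φ : ℝ → ℝ} {μ : ∀ i, Xs i → ℝ} {K : ∀ i, Xs i → Ys i → ℝ}
    (hμ : ∀ i, IsPosDist (μ i)) (hK : ∀ i, IsChannel (K i))
    (hp : ∀ i y, 0 < push (μ i) (K i) y) {η : ℝ}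
    (h : Contracts Φ (fun x : ∀ i, Xs i => ∏ i, μ i (x i))
        (fun (x : ∀ i, Xs i) (y : ∀ i, Ys i) => ∏ i, K i (x i) (y i)) η) (i : ι) :
    Contracts Φ (μ i) (K i) η := by
  intro f hf
  have h1 := h (fun x => f (x i)) fun x => hf _
  have hcond : condExp (fun x : ∀ i, Xs i => ∏ i, μ i (x i))
      (fun (x : ∀ i, Xs i) (y : ∀ i, Ys i) => ∏ i, K i (x i) (y i)) (fun x => f (x i)) =
      fun y => condExp (μ i) (K i) f (y i) := by
    funext y
    rw [condExp, push_pi, condExp]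
    simp only [← Finset.prod_mul_distrib]
    rw [sum_pi_mul_apply (fun j x => μ j x * K j x (y j)) i f,
      ← Finset.mul_prod_erase _ _ (Finset.mem_univ i)]
    exact mul_div_mul_right _ _ (Finset.prod_pos fun j _ => hp j (y j)).ne'
  rwa [hcond, push_pi, Ent_pi_apply Φ (fun j => isPosDist_push (hμ j) (hK j) (hp j)),
    Ent_pi_apply Φ hμ] at h1

end Pi

/-- A common contraction constant of the factors is one of the product. -/
theorem Contracts.pi {Φ : ℝ → ℝ} (hsub : Subadditive Φ) {η : ℝ} (h0 : 0 ≤ η) (h1 : η ≤ 1) :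
    ∀ {n : ℕ} {Xs Ys : Fin n → Type} [∀ i, Fintype (Xs i)] [∀ i, Fintype (Ys i)]
      {μ : ∀ i, Xs i → ℝ} {K : ∀ i, Xs i → Ys i → ℝ},
      (∀ i, IsPosDist (μ i)) → (∀ i, IsChannel (K i)) → (∀ i y, 0 < push (μ i) (K i) y) →
      (∀ i, Contracts Φ (μ i) (K i) η) →
      Contracts Φ (fun x : ∀ i, Xs i => ∏ i, μ i (x i))
        (fun (x : ∀ i, Xs i) (y : ∀ i, Ys i) => ∏ i, K i (x i) (y i)) η := by
  intro n
  induction n with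
  | zero =>
    intro Xs Ys _ _ μ K _ _ _ _ f _
    simp [Ent, condExp, push]
  | succ n ih =>
    intro Xs Ys _ _ μ K hμ hK hp hc
    refine Contracts.of_equiv (Fin.consEquiv Xs) (Fin.consEquiv Ys) ?_
    have hp' : ∀ y, 0 < push (fun x : ∀ i : Fin n, Xs i.succ => ∏ i, μ i.succ (x i))
        (fun (x : ∀ i : Fin n, Xs i.succ) (y : ∀ i : Fin n, Ys i.succ) =>
          ∏ i, K i.succ (x i) (y i)) y := by
      intro y
      rw [push_pi]
      exact Finset.prod_pos fun i _ => hp _ _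
    have h := Contracts.prod hsub (hμ 0) (isPosDist_pi fun i : Fin n => hμ i.succ) (hK 0)
      (isChannel_pi fun i : Fin n => hK i.succ) (hp 0) hp' h0 h1 (hc 0)
      (ih (fun i => hμ i.succ) (fun i => hK i.succ) (fun i => hp i.succ) fun i => hc i.succ)
    simpa [Fin.prod_univ_succ, Fin.consEquiv] using h

/-- Theorem (tensorization of SDPI constants): if the `Φ`-entropy is subadditive and
homogeneous, then for admissible pairs `(μᵢ,Kᵢ)`, `i = 1,…,n`, the SDPI constant of the
product pair equals the maximum of the individual SDPI constants. -/
theorem statement8 (Φ : ℝ → ℝ) (hconv : ConvexOn ℝ (Set.Ici 0) Φ)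
    (hsub : Subadditive Φ) (hhom : Homogeneous Φ)
    (n : ℕ) (hn : 0 < n)
    (Xs Ys : Fin n → Type) [∀ i, Fintype (Xs i)] [∀ i, Fintype (Ys i)]
    [∀ i, Nonempty (Xs i)] [∀ i, Nonempty (Ys i)]
    (μ : ∀ i, Xs i → ℝ) (K : ∀ i, Xs i → Ys i → ℝ)
    (hμ : ∀ i, IsPosDist (μ i)) (hK : ∀ i, IsChannel (K i))
    (hadm : ∀ i y, 0 < push (μ i) (K i) y) :
    eta Φ (fun x : ∀ i, Xs i => ∏ i, μ i (x i))
        (fun (x : ∀ i, Xs i) (y : ∀ i, Ys i) => ∏ i, K i (x i) (y i)) =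
      Finset.univ.sup' (Finset.univ_nonempty_iff.mpr ⟨⟨0, hn⟩⟩)
        (fun i => eta Φ (μ i) (K i)) := by
  have hp : ∀ y, 0 < push (fun x : ∀ i, Xs i => ∏ i, μ i (x i))
      (fun (x : ∀ i, Xs i) (y : ∀ i, Ys i) => ∏ i, K i (x i) (y i)) y := by
    intro y
    rw [push_pi]
    exact Finset.prod_pos fun i _ => hadm i _
  have hP := isPosDist_pi hμ
  have hC := isChannel_pi hK
  apply le_antisymm
  · have hle := fun i => Finset.le_sup' (fun i => eta Φ (μ i) (K i)) (Finset.mem_univ i)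
    have h0 := (eta_nonneg_s8 hconv (hμ ⟨0, hn⟩) (hK _) (hadm _)).trans (hle ⟨0, hn⟩)
    refine eta_le_s8 hconv hP hC hp h0 (Contracts.pi hsub h0 ?_ hμ hK hadm fun i =>
      (contracts_eta hconv hhom (hμ i) (hK i) (hadm i)).mono hconv (hμ i) (hle i))
    exact Finset.sup'_le _ _ fun i _ => eta_le_s8 hconv (hμ i) (hK i) (hadm i) zero_le_one
      (contracts_one hconv (hμ i) (hK i) (hadm i))
  · exact Finset.sup'_le _ _ fun i _ => eta_le_s8 hconv (hμ i) (hK i) (hadm i)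
      (eta_nonneg_s8 hconv hP hC hp)
      ((contracts_eta hconv hhom hP hC hp).of_pi hμ hK hadm i)

end SDPI
end
end
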